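/- arXiv:2206.11369 — 2 statements merged into one kernel-verified Lean document; each statement's English description precedes it below -/
import Mathlib

section
/- Let r be a probability distribution on 𝒳̂, and for β > 0 let q_β := q[r] be the associated encoder. Then for every integer α₀ ≥ 1, every β > 0, and every x̂ ∈ 𝒳̂: ∂^{α₀}/∂β^{α₀} [ r(x̂) − BA_β[r](x̂) ] = − ∑_x p_X(x)·q_β(x̂|x)·P_{α₀}[q_β; d](x̂, x), where the derivative is taken in β with r held fixed. -/
open scoped BigOperators

variable {X Xhat : Type*} [Fintype X] [Fintype Xhat]

/-- The partition function `Z(x, β) = ∑_{x̂'} r(x̂')·e^{−β d(x,x̂')}`. -/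
noncomputable def Zf (d : X → Xhat → ℝ) (r : Xhat → ℝ) (β : ℝ) (x : X) : ℝ :=
  ∑ xh' : Xhat, r xh' * Real.exp (-β * d x xh')

/-- The encoder `q[r](x̂|x) = r(x̂)·e^{−β d(x,x̂)} / Z(x,β)`. -/
noncomputable def enc (d : X → Xhat → ℝ) (r : Xhat → ℝ) (β : ℝ) (xh : Xhat) (x : X) : ℝ :=
  r xh * Real.exp (-β * d x xh) / Zf d r β x

/-- The Blahut–Arimoto iteration `BA_β[r](x̂) = ∑_x p_X(x)·q[r](x̂|x)`. -/
noncomputable def BA (p : X → ℝ) (d : X → Xhat → ℝ) (β : ℝ) (r : Xhat → ℝ) (xh : Xhat) : ℝ :=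
  ∑ x : X, p x * enc d r β xh x

/-- The ℝ-linear derivation `d̄` on `ℝ[x₀, x₁, x₂, …]` determined by `d̄x₀ = 0` and
`d̄x_k = x₁·x_k − x_{k+1}` for `k ≥ 1`. -/
noncomputable def dbar : Derivation ℝ (MvPolynomial ℕ ℝ) (MvPolynomial ℕ ℝ) :=
  MvPolynomial.mkDerivation ℝ fun k =>
    if k = 0 then 0 else MvPolynomial.X 1 * MvPolynomial.X k - MvPolynomial.X (k + 1)

/-- The polynomials `P_k`: `P₀ = 1`, `P_{k+1} = (x₁ − x₀)·P_k + d̄P_k`. -/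
noncomputable def P : ℕ → MvPolynomial ℕ ℝ
  | 0 => 1
  | k + 1 => (MvPolynomial.X 1 - MvPolynomial.X 0) * P k + dbar (P k)

/-- `P_k[q; d](x̂, x)`: the polynomial `P_k` evaluated at `x₀ = d(x,x̂)` and
`x_j = ∑_{x̂'} q(x̂'|x)·d(x,x̂')^j` for `j ≥ 1`. -/
noncomputable def Pval (d : X → Xhat → ℝ) (q : Xhat → X → ℝ) (k : ℕ) (xh : Xhat) (x : X) : ℝ :=
  MvPolynomial.eval
    (fun j => if j = 0 then d x xh else ∑ xh' : Xhat, q xh' x * d x xh' ^ j) (P k)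

/-- The point `(d(x,x̂), ∑ q d, ∑ q d², …)` at which the `P_k` are evaluated. -/
noncomputable def momentPoint (d : X → Xhat → ℝ) (r : Xhat → ℝ) (xh : Xhat) (x : X) (β : ℝ) :
    ℕ → ℝ :=
  fun j => if j = 0 then d x xh else ∑ xh' : Xhat, enc d r β xh' x * d x xh' ^ j

theorem Zf_pos {S T : Type*} [Fintype T] (d : S → T → ℝ) {r : T → ℝ}
    (hr0 : ∀ xh, 0 ≤ r xh) (hr1 : ∑ xh, r xh = 1) (β : ℝ) (x : S) :
    0 < Zf d r β x := by
  obtain ⟨i, -, hi⟩ : ∃ i ∈ Finset.univ, 0 < r i :=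
    Finset.exists_lt_of_sum_lt (f := fun _ => (0 : ℝ)) (by simp [hr1])
  exact Finset.sum_pos' (fun j _ => mul_nonneg (hr0 j) (Real.exp_pos _).le)
    ⟨i, Finset.mem_univ _, mul_pos hi (Real.exp_pos _)⟩

theorem hasDerivAt_mul_exp_neg_mul (a c β : ℝ) :
    HasDerivAt (fun b => a * Real.exp (-b * c)) (-(a * Real.exp (-β * c) * c)) β := by
  refine (((hasDerivAt_neg β).mul_const c).exp.const_mul a).congr_deriv ?_
  ring

theorem hasDerivAt_enc {S T : Type*} [Fintype T] (d : S → T → ℝ) {r : T → ℝ}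
    (β : ℝ) (xh : T) {x : S} (hZ : Zf d r β x ≠ 0) :
    HasDerivAt (fun b => enc d r b xh x)
      (enc d r β xh x * (∑ xh', enc d r β xh' x * d x xh' - d x xh)) β := by
  have hZ' : HasDerivAt (fun b => Zf d r b x)
      (∑ xh', -(r xh' * Real.exp (-β * d x xh') * d x xh')) β :=
    HasDerivAt.fun_sum fun xh' _ => hasDerivAt_mul_exp_neg_mul _ _ β
  refine ((hasDerivAt_mul_exp_neg_mul _ _ β).div hZ' hZ).congr_deriv ?_
  have hmean : ∑ xh', enc d r β xh' x * d x xh' =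
      (∑ xh', r xh' * Real.exp (-β * d x xh') * d x xh') / Zf d r β x := by
    rw [Finset.sum_div]
    exact Finset.sum_congr rfl fun _ _ => div_mul_eq_mul_div _ _ _
  rw [hmean, Finset.sum_neg_distrib, enc]
  field_simp
  ring

theorem hasDerivAt_momentPoint {S T : Type*} [Fintype T] (d : S → T → ℝ) {r : T → ℝ}
    (β : ℝ) (xh : T) {x : S} (hZ : Zf d r β x ≠ 0) (k : ℕ) :
    HasDerivAt (fun b => momentPoint d r xh x b k)
      (MvPolynomial.eval (momentPoint d r xh x β) (dbar (MvPolynomial.X k))) β := by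
  rcases Nat.eq_zero_or_pos k with rfl | hk
  · simpa [momentPoint, dbar, MvPolynomial.mkDerivation_X] using hasDerivAt_const β (d x xh)
  · have hk0 := hk.ne'
    simp only [dbar, MvPolynomial.mkDerivation_X, momentPoint, hk0, if_false, map_sub, map_mul,
      MvPolynomial.eval_X, one_ne_zero, pow_one, Nat.succ_ne_zero]
    refine (HasDerivAt.fun_sum fun xh' _ =>
      (hasDerivAt_enc d β xh' hZ).mul_const (d x xh' ^ k)).congr_deriv ?_
    rw [Finset.mul_sum, ← Finset.sum_sub_distrib]
    exact Finset.sum_congr rfl fun _ _ => by ring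

theorem hasDerivAt_eval_momentPoint {S T : Type*} [Fintype T] (d : S → T → ℝ) {r : T → ℝ}
    (β : ℝ) (xh : T) {x : S} (hZ : Zf d r β x ≠ 0) (Q : MvPolynomial ℕ ℝ) :
    HasDerivAt (fun b => MvPolynomial.eval (momentPoint d r xh x b) Q)
      (MvPolynomial.eval (momentPoint d r xh x β) (dbar Q)) β := by
  induction Q using MvPolynomial.induction_on with
  | C a => simpa [dbar] using hasDerivAt_const β a
  | add Q₁ Q₂ h₁ h₂ => simpa using h₁.fun_add h₂
  | mul_X Q k h =>
    simp only [map_mul, MvPolynomial.eval_X, Derivation.leibniz, smul_eq_mul, map_add]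
    refine (h.fun_mul (hasDerivAt_momentPoint d β xh hZ k)).congr_deriv ?_
    ring

theorem hasDerivAt_enc_mul_Pval {S T : Type*} [Fintype T] (d : S → T → ℝ) {r : T → ℝ}
    (β : ℝ) (xh : T) {x : S} (hZ : Zf d r β x ≠ 0) (n : ℕ) :
    HasDerivAt (fun b => enc d r b xh x * Pval d (fun a c => enc d r b a c) n xh x)
      (enc d r β xh x * Pval d (fun a c => enc d r β a c) (n + 1) xh x) β := by
  refine ((hasDerivAt_enc d β xh hZ).fun_mul
    (hasDerivAt_eval_momentPoint d β xh hZ (P n))).congr_deriv ?_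
  unfold momentPoint
  simp only [Pval, P, map_add, map_mul, map_sub, MvPolynomial.eval_X, if_true, one_ne_zero,
    if_false, pow_one]
  ring

theorem iteratedDeriv_BA (p : X → ℝ) (d : X → Xhat → ℝ) {r : Xhat → ℝ}
    (hr0 : ∀ xh, 0 ≤ r xh) (hr1 : ∑ xh, r xh = 1) (xh : Xhat) (n : ℕ) :
    iteratedDeriv n (fun b => BA p d b r xh) =
      fun b => ∑ x, p x * enc d r b xh x * Pval d (fun a c => enc d r b a c) n xh x := by
  induction n with
  | zero =>
    funext b
    simp [BA, Pval, P]
  | succ n ih =>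
    rw [iteratedDeriv_succ, ih]
    funext b
    simp only [mul_assoc]
    exact (HasDerivAt.fun_sum fun x _ =>
      (hasDerivAt_enc_mul_Pval d b xh (Zf_pos d hr0 hr1 b x).ne' n).const_mul (p x)).deriv

/-- **Repeated partial `β`-derivatives of `Id − BA_β`** (Theorem
`thm:high-order-derivs-of-BA-in-main-text`, Equation for `∂^{α₀}/∂β^{α₀}`):
`∂^{α₀}/∂β^{α₀} [r(x̂) − BA_β[r](x̂)] = −∑_x p(x)·q_β(x̂|x)·P_{α₀}[q_β; d](x̂, x)`,
with `r` held fixed. -/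
theorem repeatedBetaDerivIdSubBA (p : X → ℝ) (hp0 : ∀ x, 0 ≤ p x) (hp1 : ∑ x, p x = 1)
    (d : X → Xhat → ℝ) (r : Xhat → ℝ)
    (hr0 : ∀ xh, 0 ≤ r xh) (hr1 : ∑ xh, r xh = 1) :
    ∀ α₀ : ℕ, 1 ≤ α₀ → ∀ β : ℝ, 0 < β → ∀ xh : Xhat,
      iteratedDeriv α₀ (fun β' => r xh - BA p d β' r xh) β =
        -∑ x, p x * enc d r β xh x * Pval d (fun a c => enc d r β a c) α₀ xh x := by
  intro n hn β _ xh
  rw [iteratedDeriv_const_sub hn, iteratedDeriv_neg, iteratedDeriv_BA p d hr0 hr1]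
end

section
/- Let β > 0, let r be a probability distribution on 𝒳̂ with r(x̂) > 0 for all x̂, and let q := q[r] be the associated encoder. Enumerate 𝒳̂ = {x̂_1,…,x̂_M}. Let α = (α₀, α₊) ∈ ℕ × ℕ^M with α₊ = (α_1,…,α_M) ≠ 0, and write |α₊| := ∑_i α_i and α! := α₀!·∏_i α_i!. Then the mixed partial derivative of the map (β, r) ↦ r(x̂) − BA_β[r](x̂), taken α₀ times with respect to β and α_i times with respect to each coordinate r(x̂_i), equals δ_{α, e_{x̂}} − (−1)^{|α₊|−1}·(|α₊|−1)!·α! · ∑_x p_X(x)·∏_{i=1}^M (q(x̂_i|x)/r(x̂_i))^{α_i} · ∑_{k ∈ ℕ^M : k_1+⋯+k_M = α₀} ( ∏_{i : x̂_i ≠ x̂} G(k_i, α_i)[q;d](x̂_i, x) ) · [ α_{x̂}·G(k_{x̂}, α_{x̂})[q;d](x̂, x) − |α₊|·(1 + α_{x̂})·q(x̂|x)·G(k_{x̂}, 1 + α_{x̂})[q;d](x̂, x) ], where α_{x̂} and k_{x̂} denote the coordinates of α₊ and k at the index of x̂, and δ_{α, e_{x̂}} equals 1 if α₀ = 0 and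 α₊ is the indicator vector of x̂, and 0 otherwise. -/
open scoped BigOperators

variable {X Xhat : Type*} [Fintype X] [Fintype Xhat] [DecidableEq Xhat]

/-- `G(k, a)` applied to the sequence `v j = P_j[q;d](x̂,x)`: zero if `a = 0 < k`, otherwise
`∑_{t ∈ ℕ^k, |t| ≤ a, ∑ j·t_j = k} [1/(t!·(a−|t|)!)] ∏_{j=1}^k (v j / j!)^{t_j}`. -/
noncomputable def Gfun (k a : ℕ) (v : ℕ → ℝ) : ℝ :=
  if a = 0 ∧ 0 < k then 0
  else
    ∑ t ∈ (Fintype.piFinset fun _ : Fin k => Finset.range (k + 1)).filter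
        (fun t => (∑ j, t j) ≤ a ∧ (∑ j : Fin k, ((j : ℕ) + 1) * t j) = k),
      ((1 : ℝ) / (((∏ j, (t j).factorial) * (a - ∑ j, t j).factorial : ℕ) : ℝ)) *
        ∏ j : Fin k, (v ((j : ℕ) + 1) / (((j : ℕ) + 1).factorial : ℝ)) ^ t j

/-- Partial derivative in `β` of a function `f(β, r)`. -/
noncomputable def pB (f : ℝ → (Xhat → ℝ) → ℝ) : ℝ → (Xhat → ℝ) → ℝ :=
  fun β r => deriv (fun c => f c r) β

/-- Partial derivative in the coordinate `r(j)` of a function `f(β, r)`. -/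
noncomputable def pR (j : Xhat) (f : ℝ → (Xhat → ℝ) → ℝ) : ℝ → (Xhat → ℝ) → ℝ :=
  fun β r => fderiv ℝ (fun r' => f β r') r (Pi.single j 1)

/-- The mixed partial derivative: `α₀` times in `β` and `αp i` times in each coordinate
`r(x̂ᵢ)`. -/
noncomputable def mixedD (α₀ : ℕ) (αp : Xhat → ℕ) (f : ℝ → (Xhat → ℝ) → ℝ) :
    ℝ → (Xhat → ℝ) → ℝ :=
  (Finset.univ : Finset Xhat).toList.foldr (fun j g => (pR j)^[αp j] g) (pB^[α₀] f)

/-- Smoothness of `f(β, r)` at every point with `r` in the open positive orthant. -/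
def SmoothOnPos (f : ℝ → (Xhat → ℝ) → ℝ) : Prop :=
  ∀ β r, (∀ i, 0 < r i) →
    ContDiffAt ℝ ((⊤ : ℕ∞) : WithTop ℕ∞) (fun z : ℝ × (Xhat → ℝ) => f z.1 z.2) (β, r)

/-- Agreement of two functions of `(β, r)` for `r` in the open positive orthant. -/
def EqOnPos (f g : ℝ → (Xhat → ℝ) → ℝ) : Prop :=
  ∀ β r, (∀ i, 0 < r i) → f β r = g β r

omit [DecidableEq Xhat] in
theorem eventually_pos {r : Xhat → ℝ} (hr : ∀ i, 0 < r i) :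
    ∀ᶠ r' in nhds r, ∀ i, 0 < r' i :=
  Filter.eventually_all.2 fun i =>
    (continuous_apply i).continuousAt.eventually (lt_mem_nhds (hr i))

omit [DecidableEq Xhat] in
theorem eventually_snd_pos {β : ℝ} {r : Xhat → ℝ} (hr : ∀ i, 0 < r i) :
    ∀ᶠ z : ℝ × (Xhat → ℝ) in nhds (β, r), ∀ i, 0 < z.2 i :=
  continuous_snd.continuousAt.eventually (eventually_pos hr)

omit [Fintype Xhat] [DecidableEq Xhat] in
theorem EqOnPos.pB {f g : ℝ → (Xhat → ℝ) → ℝ} (h : EqOnPos f g) : EqOnPos (pB f) (pB g) := by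
  intro β r hr
  simp only [_root_.pB]
  congr 1
  funext c
  exact h c r hr

theorem EqOnPos.pR {f g : ℝ → (Xhat → ℝ) → ℝ} (h : EqOnPos f g) (j : Xhat) :
    EqOnPos (pR j f) (pR j g) := by
  intro β r hr
  simp only [_root_.pR]
  have : (fun r' => f β r') =ᶠ[nhds r] fun r' => g β r' := by
    filter_upwards [eventually_pos hr] with r' hr' using h β r' hr'
  rw [this.fderiv_eq]

omit [DecidableEq Xhat] in
theorem SmoothOnPos.congr {f g : ℝ → (Xhat → ℝ) → ℝ} (hg : SmoothOnPos g) (h : EqOnPos f g) :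
    SmoothOnPos f := by
  intro β r hr
  refine (hg β r hr).congr_of_eventuallyEq ?_
  filter_upwards [eventually_snd_pos hr] with z hz using h _ _ hz

omit [DecidableEq Xhat] in
theorem SmoothOnPos.differentiableAt {f : ℝ → (Xhat → ℝ) → ℝ} (hf : SmoothOnPos f) (β : ℝ)
    {r : Xhat → ℝ} (hr : ∀ i, 0 < r i) :
    DifferentiableAt ℝ (fun z : ℝ × (Xhat → ℝ) => f z.1 z.2) (β, r) :=
  (hf β r hr).differentiableAt (by simp)

omit [DecidableEq Xhat] in
theorem SmoothOnPos.pB_eqOnPos {f : ℝ → (Xhat → ℝ) → ℝ} (hf : SmoothOnPos f) :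
    EqOnPos (pB f)
      (fun β r => fderiv ℝ (fun z : ℝ × (Xhat → ℝ) => f z.1 z.2) (β, r) (1, 0)) := by
  intro β r hr
  have h2 : HasDerivAt (fun c : ℝ => (c, r)) ((1 : ℝ), (0 : Xhat → ℝ)) β :=
    (hasDerivAt_id β).prodMk (hasDerivAt_const β r)
  exact ((hf.differentiableAt β hr).hasFDerivAt.comp_hasDerivAt β h2).deriv

theorem SmoothOnPos.pR_eqOnPos {f : ℝ → (Xhat → ℝ) → ℝ} (hf : SmoothOnPos f) (j : Xhat) :
    EqOnPos (pR j f)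
      (fun β r => fderiv ℝ (fun z : ℝ × (Xhat → ℝ) => f z.1 z.2) (β, r) (0, Pi.single j 1)) := by
  intro β r hr
  have h2 : HasFDerivAt (fun r' : Xhat → ℝ => (β, r'))
      (ContinuousLinearMap.inr ℝ ℝ (Xhat → ℝ)) r := hasFDerivAt_prodMk_right β r
  have h3 := ((hf.differentiableAt β hr).hasFDerivAt.comp r h2).fderiv
  have h4 := DFunLike.congr_fun h3 (Pi.single j 1)
  simpa [_root_.pR, Function.comp_def] using h4

omit [DecidableEq Xhat] in
theorem SmoothOnPos.fderiv_apply {f : ℝ → (Xhat → ℝ) → ℝ} (hf : SmoothOnPos f)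
    (v : ℝ × (Xhat → ℝ)) :
    SmoothOnPos (fun β r => fderiv ℝ (fun z : ℝ × (Xhat → ℝ) => f z.1 z.2) (β, r) v) := by
  intro β r hr
  exact ((hf β r hr).fderiv_right (m := ((⊤ : ℕ∞) : WithTop ℕ∞)) (by simp)).clm_apply
    contDiffAt_const

omit [DecidableEq Xhat] in
theorem SmoothOnPos.pB {f : ℝ → (Xhat → ℝ) → ℝ} (hf : SmoothOnPos f) : SmoothOnPos (pB f) :=
  (hf.fderiv_apply _).congr hf.pB_eqOnPos

theorem SmoothOnPos.pR {f : ℝ → (Xhat → ℝ) → ℝ} (hf : SmoothOnPos f) (j : Xhat) :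
    SmoothOnPos (pR j f) :=
  (hf.fderiv_apply _).congr (hf.pR_eqOnPos j)

omit [DecidableEq Xhat] in
theorem SmoothOnPos.fderiv_fderiv_comm {f : ℝ → (Xhat → ℝ) → ℝ} (hf : SmoothOnPos f)
    (v w : ℝ × (Xhat → ℝ)) {β : ℝ} {r : Xhat → ℝ} (hr : ∀ i, 0 < r i) :
    fderiv ℝ (fun z => fderiv ℝ (fun z : ℝ × (Xhat → ℝ) => f z.1 z.2) z v) (β, r) w =
      fderiv ℝ (fun z => fderiv ℝ (fun z : ℝ × (Xhat → ℝ) => f z.1 z.2) z w) (β, r) v := by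
  have hd : DifferentiableAt ℝ (fderiv ℝ (fun z : ℝ × (Xhat → ℝ) => f z.1 z.2)) (β, r) :=
    ((hf β r hr).fderiv_right (m := 1)
      (by norm_cast)).differentiableAt one_ne_zero
  have hs : IsSymmSndFDerivAt ℝ (fun z : ℝ × (Xhat → ℝ) => f z.1 z.2) (β, r) :=
    (hf β r hr).isSymmSndFDerivAt (by simp; norm_cast)
  have key (u : ℝ × (Xhat → ℝ)) :
      fderiv ℝ (fun z => fderiv ℝ (fun z : ℝ × (Xhat → ℝ) => f z.1 z.2) z u) (β, r) =
        (fderiv ℝ (fderiv ℝ (fun z : ℝ × (Xhat → ℝ) => f z.1 z.2)) (β, r)).flip u := by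
    simpa using (hd.hasFDerivAt.clm_apply (hasFDerivAt_const u (β, r))).fderiv
  rw [key, key]
  exact hs w v

theorem SmoothOnPos.pR_pB_comm {f : ℝ → (Xhat → ℝ) → ℝ} (hf : SmoothOnPos f) (j : Xhat) :
    EqOnPos (_root_.pR j (_root_.pB f)) (_root_.pB (_root_.pR j f)) := by
  intro β r hr
  rw [(hf.pB_eqOnPos.pR j) β r hr, (hf.pR_eqOnPos j).pB β r hr,
    (hf.fderiv_apply _).pR_eqOnPos j β r hr, (hf.fderiv_apply _).pB_eqOnPos β r hr]
  exact hf.fderiv_fderiv_comm _ _ hr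

omit [Fintype Xhat] [DecidableEq Xhat] in
theorem EqOnPos.pB_iterate {f g : ℝ → (Xhat → ℝ) → ℝ} (h : EqOnPos f g) (n : ℕ) :
    EqOnPos (_root_.pB^[n] f) (_root_.pB^[n] g) := by
  induction n with
  | zero => exact h
  | succ n ih => simpa only [Function.iterate_succ_apply'] using ih.pB

theorem EqOnPos.pR_iterate {f g : ℝ → (Xhat → ℝ) → ℝ} (h : EqOnPos f g) (j : Xhat) (n : ℕ) :
    EqOnPos ((_root_.pR j)^[n] f) ((_root_.pR j)^[n] g) := by
  induction n with
  | zero => exact h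
  | succ n ih => simpa only [Function.iterate_succ_apply'] using ih.pR j

omit [DecidableEq Xhat] in
theorem SmoothOnPos.pB_iterate {f : ℝ → (Xhat → ℝ) → ℝ} (h : SmoothOnPos f) (n : ℕ) :
    SmoothOnPos (_root_.pB^[n] f) := by
  induction n with
  | zero => exact h
  | succ n ih => simpa only [Function.iterate_succ_apply'] using ih.pB

theorem SmoothOnPos.pR_iterate {f : ℝ → (Xhat → ℝ) → ℝ} (h : SmoothOnPos f) (j : Xhat) (n : ℕ) :
    SmoothOnPos ((_root_.pR j)^[n] f) := by
  induction n with
  | zero => exact h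
  | succ n ih => simpa only [Function.iterate_succ_apply'] using ih.pR j

theorem SmoothOnPos.pR_pB_iterate_comm {f : ℝ → (Xhat → ℝ) → ℝ} (hf : SmoothOnPos f) (j : Xhat)
    (n : ℕ) : EqOnPos (_root_.pR j (_root_.pB^[n] f)) (_root_.pB^[n] (_root_.pR j f)) := by
  induction n with
  | zero => exact fun _ _ _ => rfl
  | succ n ih =>
    intro β r hr
    rw [Function.iterate_succ_apply', Function.iterate_succ_apply',
      (hf.pB_iterate n).pR_pB_comm j β r hr]
    exact ih.pB β r hr

theorem SmoothOnPos.pR_iterate_pB_iterate_comm {f : ℝ → (Xhat → ℝ) → ℝ} (hf : SmoothOnPos f)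
    (j : Xhat) (m n : ℕ) :
    EqOnPos ((_root_.pR j)^[m] (_root_.pB^[n] f)) (_root_.pB^[n] ((_root_.pR j)^[m] f)) := by
  induction m with
  | zero => exact fun _ _ _ => rfl
  | succ m ih =>
    intro β r hr
    rw [Function.iterate_succ_apply', Function.iterate_succ_apply', ih.pR j β r hr]
    exact (hf.pR_iterate j m).pR_pB_iterate_comm j n β r hr

theorem SmoothOnPos.foldr_pR {f : ℝ → (Xhat → ℝ) → ℝ} (hf : SmoothOnPos f) (a : Xhat → ℕ)
    (l : List Xhat) : SmoothOnPos (l.foldr (fun j g => (_root_.pR j)^[a j] g) f) := by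
  induction l with
  | nil => exact hf
  | cons j l ih => exact ih.pR_iterate j (a j)

/-- The derivatives in `β` may be taken after those in `r`. -/
theorem SmoothOnPos.mixedD_eqOnPos {f : ℝ → (Xhat → ℝ) → ℝ} (hf : SmoothOnPos f) (n : ℕ)
    (a : Xhat → ℕ) :
    EqOnPos (mixedD n a f) (_root_.pB^[n] (mixedD 0 a f)) := by
  simp only [mixedD, Function.iterate_zero, id]
  induction (Finset.univ : Finset Xhat).toList with
  | nil => exact fun _ _ _ => rfl
  | cons j l ih =>
    intro β r hr
    simp only [List.foldr_cons]
    rw [ih.pR_iterate j (a j) β r hr]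
    exact (hf.foldr_pR a l).pR_iterate_pB_iterate_comm j (a j) n β r hr

/-- The exponential generating series of the iterated derivatives of `f` at `x`. -/
noncomputable def derivSeries (f : ℝ → ℝ) (x : ℝ) : PowerSeries ℝ :=
  PowerSeries.mk fun k => iteratedDeriv k f x / (k.factorial : ℝ)

theorem iteratedDeriv_eq_coeff_derivSeries (f : ℝ → ℝ) (x : ℝ) (k : ℕ) :
    iteratedDeriv k f x = (k.factorial : ℝ) * PowerSeries.coeff k (derivSeries f x) := by
  rw [derivSeries, PowerSeries.coeff_mk, mul_div_cancel₀]
  positivity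

theorem derivSeries_one (x : ℝ) : derivSeries (fun _ => 1) x = 1 := by
  ext k
  rw [derivSeries, PowerSeries.coeff_mk, PowerSeries.coeff_one, iteratedDeriv_const]
  split_ifs with h <;> simp [h]

theorem derivSeries_mul {f g : ℝ → ℝ} {x : ℝ}
    (hf : ContDiffAt ℝ ((⊤ : ℕ∞) : WithTop ℕ∞) f x)
    (hg : ContDiffAt ℝ ((⊤ : ℕ∞) : WithTop ℕ∞) g x) :
    derivSeries (fun c => f c * g c) x = derivSeries f x * derivSeries g x := by
  ext k
  have hk : ((k : ℕ) : WithTop ℕ∞) ≤ ((⊤ : ℕ∞) : WithTop ℕ∞) := by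
    exact_mod_cast (le_top : (k : ℕ∞) ≤ ⊤)
  rw [PowerSeries.coeff_mul, derivSeries, PowerSeries.coeff_mk,
    iteratedDeriv_fun_mul (hf.of_le hk) (hg.of_le hk),
    Finset.Nat.sum_antidiagonal_eq_sum_range_succ_mk, Finset.sum_div]
  refine Finset.sum_congr rfl fun i hi => ?_
  have hi' : i ≤ k := Nat.lt_succ_iff.1 (Finset.mem_range.1 hi)
  rw [derivSeries, derivSeries, PowerSeries.coeff_mk, PowerSeries.coeff_mk, Nat.cast_choose ℝ hi']
  field_simp

theorem derivSeries_prod {ι : Type*} (s : Finset ι) {f : ι → ℝ → ℝ} {x : ℝ}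
    (hf : ∀ i ∈ s, ContDiffAt ℝ ((⊤ : ℕ∞) : WithTop ℕ∞) (f i) x) :
    derivSeries (fun c => ∏ i ∈ s, f i c) x = ∏ i ∈ s, derivSeries (f i) x := by
  classical
  induction s using Finset.induction_on with
  | empty => simpa using derivSeries_one x
  | insert i s hi ih =>
    simp only [Finset.prod_insert hi]
    rw [derivSeries_mul (hf i (Finset.mem_insert_self i s))
      (contDiffAt_prod fun j hj => hf j (Finset.mem_insert_of_mem hj)),
      ih fun j hj => hf j (Finset.mem_insert_of_mem hj)]

theorem derivSeries_pow {f : ℝ → ℝ} {x : ℝ}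
    (hf : ContDiffAt ℝ ((⊤ : ℕ∞) : WithTop ℕ∞) f x) (a : ℕ) :
    derivSeries (fun c => f c ^ a) x = derivSeries f x ^ a := by
  simpa using derivSeries_prod (Finset.range a) (f := fun _ => f) fun _ _ => hf

/-- The exponential generating series of the sequence `v`, with constant term replaced by `1`. -/
noncomputable def expSeries (v : ℕ → ℝ) : PowerSeries ℝ :=
  PowerSeries.mk fun k => if k = 0 then 1 else v k / (k.factorial : ℝ)

theorem Gfun_eq_sum (k a : ℕ) (v : ℕ → ℝ) :
    Gfun k a v =
      ∑ t ∈ (Fintype.piFinset fun _ : Fin k => Finset.range (k + 1)).filter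
        (fun t => (∑ j, t j) ≤ a ∧ (∑ j : Fin k, ((j : ℕ) + 1) * t j) = k),
      ((1 : ℝ) / (((∏ j, (t j).factorial) * (a - ∑ j, t j).factorial : ℕ) : ℝ)) *
        ∏ j : Fin k, (v ((j : ℕ) + 1) / (((j : ℕ) + 1).factorial : ℝ)) ^ t j := by
  rw [Gfun]
  split_ifs with h
  · symm
    apply Finset.sum_eq_zero
    intro t ht
    exfalso
    obtain ⟨-, h1, h2⟩ := Finset.mem_filter.1 ht
    have h0 : ∀ j, t j = 0 := by simpa [h.1] using h1
    simp [h0] at h2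
    omega
  · rfl

theorem coeff_expSeries_pow_eq_sum (k a : ℕ) (v : ℕ → ℝ) :
    PowerSeries.coeff k (expSeries v ^ a) =
      ∑ t ∈ (Finset.univ : Finset (Fin (k + 1))).piAntidiag a,
        if ∑ i : Fin (k + 1), (i : ℕ) * t i = k then
          (Nat.multinomial Finset.univ t : ℝ) *
            ∏ i : Fin (k + 1), (PowerSeries.coeff (i : ℕ) (expSeries v)) ^ t i
        else 0 := by
  rw [← PowerSeries.coeff_coe_trunc_of_lt (Nat.lt_succ_self k), ← PowerSeries.trunc_trunc_pow,
    PowerSeries.coeff_coe_trunc_of_lt (Nat.lt_succ_self k), ← Polynomial.coe_pow,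
    Polynomial.coeff_coe]
  have h : PowerSeries.trunc (k + 1) (expSeries v) =
      ∑ i : Fin (k + 1), Polynomial.monomial (i : ℕ) (PowerSeries.coeff (i : ℕ) (expSeries v)) := by
    rw [PowerSeries.trunc_apply, Nat.Ico_zero_eq_range, Finset.sum_range]
  rw [Nat.succ_eq_add_one, h, Finset.sum_pow_eq_sum_piAntidiag, Polynomial.finsetSum_coeff]
  refine Finset.sum_congr rfl fun t _ => ?_
  have h2 : ∏ i : Fin (k + 1),
      Polynomial.monomial (i : ℕ) (PowerSeries.coeff (i : ℕ) (expSeries v)) ^ t i =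
      Polynomial.monomial (∑ i : Fin (k + 1), (i : ℕ) * t i)
        (∏ i : Fin (k + 1), (PowerSeries.coeff (i : ℕ) (expSeries v)) ^ t i) := by
    simp only [← Polynomial.C_mul_X_pow_eq_monomial, mul_pow, ← pow_mul, Finset.prod_mul_distrib,
      map_prod, map_pow, Finset.prod_pow_eq_pow_sum]
  rw [h2, ← Polynomial.C_eq_natCast, Polynomial.coeff_C_mul, Polynomial.coeff_monomial]
  split_ifs <;> simp

/-- `a! · G(k, a)` is the `k`-th coefficient of the `a`-th power of the generating series. -/
theorem coeff_expSeries_pow (k a : ℕ) (v : ℕ → ℝ) :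
    PowerSeries.coeff k (expSeries v ^ a) = (a.factorial : ℝ) * Gfun k a v := by
  rw [coeff_expSeries_pow_eq_sum, Gfun_eq_sum, ← Finset.sum_filter, Finset.mul_sum]
  refine Finset.sum_bij' (fun t _ => Fin.tail t) (fun t _ => Fin.cons (a - ∑ j, t j) t)
    ?_ ?_ ?_ ?_ ?_
  · intro t ht
    simp only [Finset.mem_filter, Finset.mem_piAntidiag, Fin.sum_univ_succ, Fin.val_zero, zero_mul,
      zero_add, Fin.val_succ] at ht
    obtain ⟨⟨h1, -⟩, h2⟩ := ht
    simp only [Finset.mem_filter, Fintype.mem_piFinset, Finset.mem_range, Fin.tail]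
    refine ⟨fun j => ?_, by omega, h2⟩
    have h3 : ((j : ℕ) + 1) * t j.succ ≤ k :=
      (Finset.single_le_sum (f := fun j : Fin k => ((j : ℕ) + 1) * t j.succ)
        (fun _ _ => Nat.zero_le _) (Finset.mem_univ j)).trans_eq h2
    nlinarith
  · intro t ht
    simp only [Finset.mem_filter] at ht
    simp only [Finset.mem_filter, Finset.mem_piAntidiag, Fin.sum_univ_succ, Fin.val_zero, zero_mul,
      zero_add, Fin.val_succ, Fin.cons_zero, Fin.cons_succ, Finset.mem_univ, implies_true, and_true]
    exact ⟨by omega, ht.2.2⟩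
  · intro t ht
    simp only [Finset.mem_filter, Finset.mem_piAntidiag, Fin.sum_univ_succ] at ht
    have : a - ∑ j, Fin.tail t j = t 0 := by simp only [Fin.tail]; omega
    rw [this, Fin.cons_self_tail]
  · intro t _
    exact Fin.tail_cons _ _
  · intro t ht
    simp only [Finset.mem_filter, Finset.mem_piAntidiag, Fin.sum_univ_succ] at ht
    have h0 : a - ∑ j, Fin.tail t j = t 0 := by simp only [Fin.tail]; omega
    have hm : (∏ i, (t i).factorial) * Nat.multinomial Finset.univ t = a.factorial := by
      rw [Nat.multinomial_spec, Fin.sum_univ_succ, ht.1.1]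
    rw [h0, ← hm, Fin.prod_univ_succ, Fin.prod_univ_succ (n := k)]
    have hc0 : PowerSeries.coeff 0 (expSeries v) = 1 := by simp [expSeries]
    have hc (j : Fin k) : PowerSeries.coeff ((j : ℕ) + 1) (expSeries v) =
        v ((j : ℕ) + 1) / (((j : ℕ) + 1).factorial : ℝ) := by simp [expSeries]
    simp only [Fin.val_zero, Fin.val_succ, hc0, hc, one_pow, one_mul, Fin.tail]
    push_cast
    have hp : (∏ j : Fin k, ((t j.succ).factorial : ℝ)) ≠ 0 :=
      Finset.prod_ne_zero_iff.2 fun j _ => by positivity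
    field_simp

omit [Fintype X] [DecidableEq Xhat] in
theorem Zf_pos_s9 [Nonempty Xhat] (d : X → Xhat → ℝ) {r : Xhat → ℝ} (hr : ∀ i, 0 < r i) (β : ℝ)
    (x : X) : 0 < Zf d r β x :=
  Finset.sum_pos (fun i _ => mul_pos (hr i) (Real.exp_pos _)) Finset.univ_nonempty

omit [Fintype X] [DecidableEq Xhat] in
theorem hasDerivAt_enc_s9 (d : X → Xhat → ℝ) {r : Xhat → ℝ} (hr : ∀ i, 0 < r i) (β : ℝ)
    (i : Xhat) (x : X) :
    HasDerivAt (fun c => enc d r c i x)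
      (enc d r β i x * ((∑ j, enc d r β j x * d x j) - d x i)) β := by
  have : Nonempty Xhat := ⟨i⟩
  have hZ0 := (Zf_pos_s9 d hr β x).ne'
  have he (j : Xhat) : HasDerivAt (fun c => r j * Real.exp (-c * d x j))
      (r j * (Real.exp (-β * d x j) * (-1 * d x j))) β :=
    (((hasDerivAt_id β).neg.mul_const (d x j)).exp).const_mul (r j)
  have hZ : HasDerivAt (fun c => Zf d r c x)
      (∑ j, r j * (Real.exp (-β * d x j) * (-1 * d x j))) β :=
    HasDerivAt.fun_sum fun j _ => he j
  refine ((he i).div hZ hZ0).congr_deriv ?_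
  have h1 : (∑ j, enc d r β j x * d x j) =
      -(∑ j, r j * (Real.exp (-β * d x j) * (-1 * d x j))) / Zf d r β x := by
    rw [← Finset.sum_neg_distrib, Finset.sum_div]
    refine Finset.sum_congr rfl fun j _ => ?_
    rw [enc]; ring
  rw [h1, enc]
  field_simp
  ring

omit [Fintype X] [DecidableEq Xhat] in
/-- Differentiation in `β` acts on polynomials in the moments of the encoder as `d̄`. -/
theorem hasDerivAt_eval_dbar (d : X → Xhat → ℝ) {r : Xhat → ℝ} (hr : ∀ i, 0 < r i) (β : ℝ)
    (i : Xhat) (x : X) (Q : MvPolynomial ℕ ℝ) :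
    HasDerivAt (fun c => MvPolynomial.eval
        (fun j => if j = 0 then d x i else ∑ i', enc d r c i' x * d x i' ^ j) Q)
      (MvPolynomial.eval
        (fun j => if j = 0 then d x i else ∑ i', enc d r β i' x * d x i' ^ j) (dbar Q)) β := by
  induction Q using MvPolynomial.induction_on with
  | C a =>
    simpa [dbar] using hasDerivAt_const β a
  | add p q hp hq =>
    simp only [map_add]
    exact hp.add hq
  | mul_X p n hp =>
    have hX : HasDerivAt (fun c => if n = 0 then d x i else ∑ i', enc d r c i' x * d x i' ^ n)
        (MvPolynomial.eval
          (fun j => if j = 0 then d x i else ∑ i', enc d r β i' x * d x i' ^ j)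
          (dbar (MvPolynomial.X n))) β := by
      by_cases hn : n = 0
      · simpa [hn, dbar] using hasDerivAt_const β (d x i)
      · have h := HasDerivAt.fun_sum (u := Finset.univ) fun i' _ =>
          (hasDerivAt_enc_s9 d hr β i' x).mul_const (d x i' ^ n)
        simp only [hn, if_false, dbar, MvPolynomial.mkDerivation_X, map_sub, map_mul,
          MvPolynomial.eval_X, one_ne_zero, Nat.succ_ne_zero, pow_one]
        refine h.congr_deriv ?_
        rw [Finset.mul_sum, ← Finset.sum_sub_distrib]
        exact Finset.sum_congr rfl fun i' _ => by ring
    have h := hp.mul hX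
    simp only [map_mul, MvPolynomial.eval_X, Derivation.leibniz, smul_eq_mul, map_add]
    refine h.congr_deriv ?_
    ring

omit [Fintype X] [DecidableEq Xhat] in
theorem iteratedDeriv_enc_div (d : X → Xhat → ℝ) {r : Xhat → ℝ} (hr : ∀ i, 0 < r i) (i : Xhat)
    (x : X) (k : ℕ) :
    iteratedDeriv k (fun c => enc d r c i x / r i) =
      fun c => enc d r c i x / r i * Pval d (fun a b => enc d r c a b) k i x := by
  induction k with
  | zero => simp [Pval, P]
  | succ k ih =>
    rw [iteratedDeriv_succ, ih]
    funext c
    have h := ((hasDerivAt_enc_s9 d hr c i x).div_const (r i)).mul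
      (hasDerivAt_eval_dbar d hr c i x (P k))
    refine h.deriv.trans ?_
    simp only [Pval, P, map_add, map_mul, map_sub, MvPolynomial.eval_X, one_ne_zero, if_false,
      if_true, pow_one]
    ring

omit [Fintype X] [DecidableEq Xhat] in
theorem derivSeries_enc_div (d : X → Xhat → ℝ) {r : Xhat → ℝ} (hr : ∀ i, 0 < r i) (β : ℝ)
    (i : Xhat) (x : X) :
    derivSeries (fun c => enc d r c i x / r i) β =
      PowerSeries.C (enc d r β i x / r i) *
        expSeries fun j => Pval d (fun a b => enc d r β a b) j i x := by
  ext k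
  rw [derivSeries, PowerSeries.coeff_mk, iteratedDeriv_enc_div d hr, PowerSeries.coeff_C_mul,
    expSeries, PowerSeries.coeff_mk, mul_div_assoc]
  split_ifs with h
  · simp [h, Pval, P]
  · rfl

omit [Fintype X] [DecidableEq Xhat] in
theorem contDiff_enc_div (d : X → Xhat → ℝ) {r : Xhat → ℝ} (hr : ∀ i, 0 < r i) (i : Xhat)
    (x : X) : ContDiff ℝ ((⊤ : ℕ∞) : WithTop ℕ∞) (fun c => enc d r c i x / r i) := by
  have : Nonempty Xhat := ⟨i⟩
  unfold enc
  refine (ContDiff.div (by fun_prop) ?_ fun c => (Zf_pos_s9 d hr c x).ne').div_const _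
  unfold Zf
  fun_prop

omit [Fintype X] in
/-- The iterated `β`-derivatives of the monomials in the ratios `q(x̂ᵢ|x)/r(x̂ᵢ)`. -/
theorem iteratedDeriv_prod_enc_div_pow (d : X → Xhat → ℝ) {r : Xhat → ℝ} (hr : ∀ i, 0 < r i)
    (β : ℝ) (x : X) (a : Xhat → ℕ) (n : ℕ) :
    iteratedDeriv n (fun c => ∏ i, (enc d r c i x / r i) ^ a i) β =
      (n.factorial : ℝ) * (∏ i, ((a i).factorial : ℝ)) * (∏ i, (enc d r β i x / r i) ^ a i) *
        ∑ k ∈ (Fintype.piFinset fun _ : Xhat => Finset.range (n + 1)).filter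
            (fun k => ∑ i, k i = n),
          ∏ i, Gfun (k i) (a i) (fun j => Pval d (fun a b => enc d r β a b) j i x) := by
  rw [iteratedDeriv_eq_coeff_derivSeries,
    derivSeries_prod _ fun i _ => ((contDiff_enc_div d hr i x).pow (a i)).contDiffAt,
    PowerSeries.coeff_prod]
  simp only [derivSeries_pow (contDiff_enc_div d hr _ x).contDiffAt, derivSeries_enc_div d hr,
    mul_pow, ← map_pow, PowerSeries.coeff_C_mul, coeff_expSeries_pow, Finset.prod_mul_distrib]
  rw [← Finset.mul_sum, ← Finset.mul_sum]
  have hsum : ∑ l ∈ Finset.finsuppAntidiag (Finset.univ : Finset Xhat) n,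
        ∏ i, Gfun (l i) (a i) (fun j => Pval d (fun a b => enc d r β a b) j i x) =
      ∑ k ∈ (Fintype.piFinset fun _ : Xhat => Finset.range (n + 1)).filter
          (fun k => ∑ i, k i = n),
        ∏ i, Gfun (k i) (a i) (fun j => Pval d (fun a b => enc d r β a b) j i x) := by
    refine Finset.sum_bij' (fun l _ => ⇑l) (fun k _ => Finsupp.equivFunOnFinite.symm k)
      ?_ ?_ ?_ ?_ ?_
    · intro l hl
      have hl' : ∑ i, l i = n := (Finset.mem_finsuppAntidiag.1 hl).1
      simp only [Finset.mem_filter, Fintype.mem_piFinset, Finset.mem_range]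
      refine ⟨fun i => Nat.lt_succ_of_le ?_, hl'⟩
      rw [← hl']
      exact Finset.single_le_sum (fun _ _ => Nat.zero_le _) (Finset.mem_univ i)
    · intro k hk
      simpa using (Finset.mem_filter.1 hk).2
    · intro l _
      ext; simp
    · intro k _
      ext; simp
    · intro l _
      rfl
  rw [hsum]
  ring

theorem prod_pow_add_single (w : Xhat → ℝ) (a : Xhat → ℕ) (j : Xhat) :
    ∏ i, w i ^ (a + Pi.single j 1 : Xhat → ℕ) i = (∏ i, w i ^ a i) * w j := by
  simp only [Pi.add_apply, pow_add, Finset.prod_mul_distrib]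
  congr 1
  rw [Finset.prod_eq_single j] <;> simp +contextual

/-- The derivative of `r(x̂)` of multi-index `a` in `r`. -/
noncomputable def coordRDeriv (xh : Xhat) (a : Xhat → ℕ) (r : Xhat → ℝ) : ℝ :=
  if a = 0 then r xh else if a = Pi.single xh 1 then 1 else 0

/-- The derivative of the encoder of multi-index `a` in `r`. -/
noncomputable def encRDeriv (d : X → Xhat → ℝ) (xh : Xhat) (x : X) (a : Xhat → ℕ) (β : ℝ)
    (r : Xhat → ℝ) : ℝ :=
  (-1) ^ (∑ i, a i) * (∏ i, Real.exp (-β * d x i) ^ a i) *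
    (((∑ i, a i).factorial : ℝ) * (r xh * Real.exp (-β * d x xh)) /
        Zf d r β x ^ ((∑ i, a i) + 1) -
      (a xh : ℝ) * (((∑ i, a i) - 1).factorial : ℝ) / Zf d r β x ^ (∑ i, a i))

/-- The derivative of `r(x̂) − BA_β[r](x̂)` of multi-index `a` in `r`. -/
noncomputable def idSubBARDeriv (p : X → ℝ) (d : X → Xhat → ℝ) (xh : Xhat) (a : Xhat → ℕ) (β : ℝ)
    (r : Xhat → ℝ) : ℝ :=
  coordRDeriv xh a r - ∑ x, p x * encRDeriv d xh x a β r

theorem idSubBARDeriv_zero (p : X → ℝ) (d : X → Xhat → ℝ) (xh : Xhat) :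
    idSubBARDeriv p d xh 0 = fun β r => r xh - BA p d β r xh := by
  funext β r
  simp [idSubBARDeriv, coordRDeriv, encRDeriv, BA, enc]

theorem smoothOnPos_idSubBARDeriv (p : X → ℝ) (d : X → Xhat → ℝ) (xh : Xhat) (a : Xhat → ℕ) :
    SmoothOnPos (idSubBARDeriv p d xh a) := by
  have : Nonempty Xhat := ⟨xh⟩
  intro β r hr
  have hcoord : ContDiffAt ℝ ((⊤ : ℕ∞) : WithTop ℕ∞)
      (fun z : ℝ × (Xhat → ℝ) => coordRDeriv xh a z.2) (β, r) := by
    unfold coordRDeriv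
    split_ifs <;> fun_prop
  have hZ (x : X) : ContDiff ℝ ((⊤ : ℕ∞) : WithTop ℕ∞)
      (fun z : ℝ × (Xhat → ℝ) => Zf d z.2 z.1 x) := by
    unfold Zf
    fun_prop
  refine hcoord.sub (ContDiffAt.sum fun x _ => contDiffAt_const.mul ?_)
  have hne (m : ℕ) : Zf d r β x ^ m ≠ 0 := pow_ne_zero m (Zf_pos_s9 d hr β x).ne'
  have hnum : ContDiff ℝ ((⊤ : ℕ∞) : WithTop ℕ∞) (fun z : ℝ × (Xhat → ℝ) =>
      ((∑ i, a i).factorial : ℝ) * (z.2 xh * Real.exp (-z.1 * d x xh))) := by fun_prop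
  refine ContDiffAt.mul (ContDiff.contDiffAt (by fun_prop)) (ContDiffAt.sub ?_ ?_)
  · exact hnum.contDiffAt.div ((hZ x).contDiffAt.pow _) (hne _)
  · exact contDiffAt_const.div ((hZ x).contDiffAt.pow _) (hne _)

theorem hasLineDerivAt_coordRDeriv (xh j : Xhat) (a : Xhat → ℕ) (r : Xhat → ℝ) :
    HasLineDerivAt ℝ (coordRDeriv xh a) (coordRDeriv xh (a + Pi.single j 1) r) r
      (Pi.single j 1) := by
  have hne : a + Pi.single j 1 ≠ 0 := fun h => by simpa using congrFun h j
  unfold HasLineDerivAt coordRDeriv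
  rw [if_neg hne]
  by_cases ha : a = 0
  · subst ha
    by_cases hj : j = xh
    · subst hj
      simpa using (hasDerivAt_id (0 : ℝ)).const_add (r j)
    · have h1 : (Pi.single j 1 : Xhat → ℕ) ≠ Pi.single xh 1 := fun h => by
        simpa [hj] using congrFun h j
      simpa [h1, Ne.symm hj] using hasDerivAt_const (0 : ℝ) (r xh)
  · have h1 : a + Pi.single j 1 ≠ Pi.single xh 1 := fun h => by
      apply ha
      have hs : ∑ i, a i = 0 := by
        have := congrArg (fun b : Xhat → ℕ => ∑ i, b i) h
        simpa [Finset.sum_add_distrib] using this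
      funext i
      exact Finset.sum_eq_zero_iff.1 hs i (Finset.mem_univ i)
    simpa [ha, h1] using hasDerivAt_const (0 : ℝ) _

omit [Fintype X] in
theorem hasLineDerivAt_encRDeriv (d : X → Xhat → ℝ) (xh j : Xhat) (x : X) (a : Xhat → ℕ) (β : ℝ)
    {r : Xhat → ℝ} (hr : ∀ i, 0 < r i) :
    HasLineDerivAt ℝ (encRDeriv d xh x a β) (encRDeriv d xh x (a + Pi.single j 1) β r) r
      (Pi.single j 1) := by
  have : Nonempty Xhat := ⟨xh⟩
  have hZ0 := (Zf_pos_s9 d hr β x).ne'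
  have hline (t : ℝ) : Zf d (r + t • Pi.single j 1) β x =
      Zf d r β x + t * Real.exp (-β * d x j) := by
    simp [Zf, add_mul, Finset.sum_add_distrib, Pi.single_apply]
  have hZ : HasDerivAt (fun t : ℝ => Zf d r β x + t * Real.exp (-β * d x j))
      (Real.exp (-β * d x j)) 0 := by
    simpa using ((hasDerivAt_id (0 : ℝ)).mul_const (Real.exp (-β * d x j))).const_add (Zf d r β x)
  have hx : HasDerivAt (fun t : ℝ => (r + t • (Pi.single j 1 : Xhat → ℝ)) xh)
      ((Pi.single j 1 : Xhat → ℝ) xh) 0 := by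
    simpa using ((hasDerivAt_id (0 : ℝ)).mul_const
      ((Pi.single j 1 : Xhat → ℝ) xh)).const_add (r xh)
  have hZ0' : Zf d r β x + 0 * Real.exp (-β * d x j) ≠ 0 := by simpa using hZ0
  have hsum : ∑ i, (a + Pi.single j 1 : Xhat → ℕ) i = (∑ i, a i) + 1 := by
    simp [Finset.sum_add_distrib]
  have hprod : ∏ i, Real.exp (-β * d x i) ^ (a + Pi.single j 1 : Xhat → ℕ) i =
      (∏ i, Real.exp (-β * d x i) ^ a i) * Real.exp (-β * d x j) :=
    prod_pow_add_single _ a j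
  unfold HasLineDerivAt encRDeriv
  simp only [hline, hsum, hprod]
  generalize hn : ∑ i, a i = n
  have h1 := ((hx.mul_const (Real.exp (-β * d x xh))).const_mul (n.factorial : ℝ)).div
    (hZ.fun_pow (n + 1)) (pow_ne_zero _ hZ0')
  have h2 := (hasDerivAt_const (0 : ℝ) ((a xh : ℝ) * ((n - 1).factorial : ℝ))).div
    (hZ.fun_pow n) (pow_ne_zero _ hZ0')
  refine ((h1.sub h2).const_mul
    ((-1) ^ n * ∏ i, Real.exp (-β * d x i) ^ a i)).congr_deriv ?_
  have hδ : (Pi.single j 1 : Xhat → ℝ) xh * Real.exp (-β * d x xh) =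
      (Pi.single j 1 : Xhat → ℝ) xh * Real.exp (-β * d x j) := by
    by_cases hj : j = xh
    · rw [hj]
    · simp [Ne.symm hj]
  have hδ' : (((a + Pi.single j 1 : Xhat → ℕ) xh : ℕ) : ℝ) = a xh + (Pi.single j 1 : Xhat → ℝ) xh := by
    simp [Pi.single_apply]
  rw [hδ, hδ']
  simp only [zero_mul, zero_smul, add_zero, Nat.add_sub_cancel]
  rcases n with _ | n
  · have ha0 : a xh = 0 := Finset.sum_eq_zero_iff.1 hn xh (Finset.mem_univ xh)
    simp only [ha0]
    simp
    field_simp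
    ring
  · simp only [Nat.add_sub_cancel, Nat.factorial_succ]
    push_cast
    field_simp
    ring

theorem pR_idSubBARDeriv (p : X → ℝ) (d : X → Xhat → ℝ) (xh j : Xhat) (a : Xhat → ℕ) :
    EqOnPos (pR j (idSubBARDeriv p d xh a)) (idSubBARDeriv p d xh (a + Pi.single j 1)) := by
  intro β r hr
  have hdiff : DifferentiableAt ℝ (fun r' => idSubBARDeriv p d xh a β r') r :=
    ((smoothOnPos_idSubBARDeriv p d xh a).differentiableAt β hr).comp r
      (hasFDerivAt_prodMk_right β r).differentiableAt
  have h : HasLineDerivAt ℝ (idSubBARDeriv p d xh a β)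
      (idSubBARDeriv p d xh (a + Pi.single j 1) β r) r (Pi.single j 1) :=
    (hasLineDerivAt_coordRDeriv xh j a r).sub
      (HasDerivAt.fun_sum fun x _ => HasDerivAt.const_mul (p x)
        (hasLineDerivAt_encRDeriv d xh j x a β hr))
  rw [pR, ← hdiff.lineDeriv_eq_fderiv]
  exact h.lineDeriv

theorem pR_iterate_idSubBARDeriv (p : X → ℝ) (d : X → Xhat → ℝ) (xh j : Xhat) (a : Xhat → ℕ)
    (m : ℕ) :
    EqOnPos ((pR j)^[m] (idSubBARDeriv p d xh a)) (idSubBARDeriv p d xh (a + Pi.single j m)) := by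
  induction m with
  | zero => intro β r _; simp
  | succ m ih =>
    intro β r hr
    rw [Function.iterate_succ_apply', ih.pR j β r hr, pR_idSubBARDeriv p d xh j _ β r hr,
      add_assoc, ← Pi.single_add]

theorem mixedD_zero_idSubBA (p : X → ℝ) (d : X → Xhat → ℝ) (xh : Xhat) (a : Xhat → ℕ) :
    EqOnPos (mixedD 0 a (fun β r => r xh - BA p d β r xh)) (idSubBARDeriv p d xh a) := by
  have key (l : List Xhat) :
      EqOnPos (l.foldr (fun j g => (pR j)^[a j] g) (idSubBARDeriv p d xh 0))
        (idSubBARDeriv p d xh (l.map fun j => Pi.single j (a j)).sum) := by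
    induction l with
    | nil => exact fun _ _ _ => rfl
    | cons j l ih =>
      intro β r hr
      rw [List.foldr_cons, ih.pR_iterate j (a j) β r hr,
        pR_iterate_idSubBARDeriv p d xh j _ _ β r hr, List.map_cons, List.sum_cons, add_comm]
  have hs : ((Finset.univ : Finset Xhat).toList.map fun j => Pi.single j (a j)).sum = a := by
    rw [Finset.sum_map_toList]
    exact Finset.univ_sum_single a
  have h1 := key (Finset.univ : Finset Xhat).toList
  rw [hs] at h1
  rw [← idSubBARDeriv_zero]
  exact h1

omit [Fintype Xhat] [DecidableEq Xhat] in
theorem pB_iterate_eq_iteratedDeriv (f : ℝ → (Xhat → ℝ) → ℝ) (n : ℕ) (β : ℝ) (r : Xhat → ℝ) :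
    pB^[n] f β r = iteratedDeriv n (fun c => f c r) β := by
  induction n generalizing β with
  | zero => simp
  | succ n ih =>
    rw [Function.iterate_succ_apply', iteratedDeriv_succ, pB]
    congr 1
    funext c
    exact ih c

omit [Fintype X] in
theorem encRDeriv_eq (d : X → Xhat → ℝ) (xh : Xhat) (x : X) {a : Xhat → ℕ} (ha : a ≠ 0) (β : ℝ)
    {r : Xhat → ℝ} (hr : ∀ i, 0 < r i) :
    encRDeriv d xh x a β r =
      (-1) ^ ((∑ i, a i) - 1) * (((∑ i, a i) - 1).factorial : ℝ) *
        ((a xh : ℝ) * (∏ i, (enc d r β i x / r i) ^ a i) -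
          ((∑ i, a i : ℕ) : ℝ) * r xh *
            ∏ i, (enc d r β i x / r i) ^ (a + Pi.single xh 1 : Xhat → ℕ) i) := by
  have : Nonempty Xhat := ⟨xh⟩
  have hZ0 := (Zf_pos_s9 d hr β x).ne'
  have hw (i : Xhat) : enc d r β i x / r i = Real.exp (-β * d x i) / Zf d r β x := by
    have := (hr i).ne'
    rw [enc]
    field_simp
  have hprod : ∏ i, (enc d r β i x / r i) ^ (a + Pi.single xh 1 : Xhat → ℕ) i =
      (∏ i, (enc d r β i x / r i) ^ a i) * (enc d r β xh x / r xh) :=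
    prod_pow_add_single _ a xh
  have hn : ∑ i, a i ≠ 0 := fun h => ha <| funext fun i =>
    Finset.sum_eq_zero_iff.1 h i (Finset.mem_univ i)
  obtain ⟨n, hn⟩ := Nat.exists_eq_succ_of_ne_zero hn
  rw [hprod]
  simp only [hw, div_pow, Finset.prod_div_distrib, Finset.prod_pow_eq_pow_sum]
  rw [encRDeriv, hn, Nat.succ_eq_add_one, Nat.add_sub_cancel, Nat.factorial_succ]
  push_cast
  field_simp
  ring

omit [Fintype X] in
theorem iteratedDeriv_encRDeriv (d : X → Xhat → ℝ) (xh : Xhat) (x : X) {a : Xhat → ℕ}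
    (ha : a ≠ 0) (β : ℝ) {r : Xhat → ℝ} (hr : ∀ i, 0 < r i) (n : ℕ) :
    iteratedDeriv n (fun c => encRDeriv d xh x a c r) β =
      (-1 : ℝ) ^ ((∑ i, a i) - 1) * (((∑ i, a i) - 1).factorial : ℝ) *
        ((n.factorial : ℝ) * ∏ i, ((a i).factorial : ℝ)) *
        ((∏ i, (enc d r β i x / r i) ^ a i) *
          ∑ k ∈ (Fintype.piFinset fun _ : Xhat => Finset.range (n + 1)).filter
              (fun k => ∑ i, k i = n),
            (∏ i ∈ Finset.univ.erase xh,
                Gfun (k i) (a i) (fun j => Pval d (fun a c => enc d r β a c) j i x)) *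
              ((a xh : ℝ) *
                  Gfun (k xh) (a xh) (fun j => Pval d (fun a c => enc d r β a c) j xh x) -
                ((∑ i, a i : ℕ) : ℝ) * ((1 + a xh : ℕ) : ℝ) * enc d r β xh x *
                  Gfun (k xh) (1 + a xh)
                    (fun j => Pval d (fun a c => enc d r β a c) j xh x))) := by
  have hsmooth (b : Xhat → ℕ) :
      ContDiffAt ℝ n (fun c => ∏ i, (enc d r c i x / r i) ^ b i) β :=
    contDiffAt_prod fun i _ => (((contDiff_enc_div d hr i x).of_le
      (by exact_mod_cast (le_top : (n : ℕ∞) ≤ ⊤))).pow (b i)).contDiffAt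
  have hrx := (hr xh).ne'
  have hprod : ∏ i, (enc d r β i x / r i) ^ (a + Pi.single xh 1 : Xhat → ℕ) i =
      (∏ i, (enc d r β i x / r i) ^ a i) * (enc d r β xh x / r xh) :=
    prod_pow_add_single _ a xh
  have hfac : ∏ i, (((a + Pi.single xh 1 : Xhat → ℕ) i).factorial : ℝ) =
      (∏ i, ((a i).factorial : ℝ)) * (a xh + 1) := by
    rw [← Finset.mul_prod_erase _ _ (Finset.mem_univ xh),
      ← Finset.mul_prod_erase (a := xh) _ (fun i => ((a i).factorial : ℝ)) (Finset.mem_univ xh),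
      Finset.prod_congr rfl (g := fun i => ((a i).factorial : ℝ)) fun i hi => by
        simp [Finset.ne_of_mem_erase hi]]
    simp only [Pi.add_apply, Pi.single_eq_same, Nat.factorial_succ]
    push_cast
    ring
  have hG (k : Xhat → ℕ) (b : Xhat → ℕ) :
      ∏ i, Gfun (k i) (b i) (fun j => Pval d (fun a c => enc d r β a c) j i x) =
        (∏ i ∈ Finset.univ.erase xh,
          Gfun (k i) (b i) (fun j => Pval d (fun a c => enc d r β a c) j i x)) *
          Gfun (k xh) (b xh) (fun j => Pval d (fun a c => enc d r β a c) j xh x) :=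
    (Finset.prod_erase_mul _ _ (Finset.mem_univ xh)).symm
  have hG' (k : Xhat → ℕ) :
      ∏ i ∈ Finset.univ.erase xh, Gfun (k i) ((a + Pi.single xh 1 : Xhat → ℕ) i)
          (fun j => Pval d (fun a c => enc d r β a c) j i x) =
        ∏ i ∈ Finset.univ.erase xh, Gfun (k i) (a i)
          (fun j => Pval d (fun a c => enc d r β a c) j i x) :=
    Finset.prod_congr rfl fun i hi => by simp [Finset.ne_of_mem_erase hi]
  have hxh : (a + Pi.single xh 1 : Xhat → ℕ) xh = 1 + a xh := by simp [add_comm]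
  simp only [encRDeriv_eq d xh x ha _ hr]
  rw [iteratedDeriv_const_mul_field,
    iteratedDeriv_fun_sub (contDiffAt_const.mul (hsmooth a)) (contDiffAt_const.mul (hsmooth _)),
    iteratedDeriv_const_mul_field, iteratedDeriv_const_mul_field,
    iteratedDeriv_prod_enc_div_pow d hr, iteratedDeriv_prod_enc_div_pow d hr, hprod, hfac]
  simp only [hG, hG', hxh, mul_sub, Finset.sum_sub_distrib]
  have hpull (c : ℝ) (S : Finset (Xhat → ℕ)) (A B : (Xhat → ℕ) → ℝ) :
      ∑ k ∈ S, A k * (c * B k) = c * ∑ k ∈ S, A k * B k := by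
    rw [Finset.mul_sum]
    exact Finset.sum_congr rfl fun k _ => by ring
  rw [hpull, hpull]
  push_cast
  field_simp
  ring

theorem iteratedDeriv_coordRDeriv (xh : Xhat) {a : Xhat → ℕ} (ha : a ≠ 0) (β : ℝ)
    (r : Xhat → ℝ) (n : ℕ) :
    iteratedDeriv n (fun _ => coordRDeriv xh a r) β =
      if n = 0 ∧ a = Pi.single xh 1 then (1 : ℝ) else 0 := by
  rw [iteratedDeriv_const, coordRDeriv, if_neg ha]
  by_cases hn : n = 0 <;> simp [hn]

/-- **Mixed partial derivatives of `Id − BA_β` of arbitrary order** (Theorem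
`thm:high-order-derivs-of-BA-in-main-text`, Equation `eq:mixed-BA-deriv-in-thm`). -/
theorem mixedDerivIdSubBA (p : X → ℝ) (hp0 : ∀ x, 0 ≤ p x) (hp1 : ∑ x, p x = 1)
    (d : X → Xhat → ℝ) (β : ℝ) (hβ : 0 < β)
    (r : Xhat → ℝ) (hr0 : ∀ xh, 0 < r xh) (hr1 : ∑ xh, r xh = 1)
    (α₀ : ℕ) (αp : Xhat → ℕ) (hαp : αp ≠ 0) (xh : Xhat) :
    mixedD α₀ αp (fun β' r' => r' xh - BA p d β' r' xh) β r =
      (if α₀ = 0 ∧ αp = Pi.single xh 1 then (1 : ℝ) else 0) -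
        (-1 : ℝ) ^ ((∑ i, αp i) - 1) * (((∑ i, αp i) - 1).factorial : ℝ) *
          ((α₀.factorial : ℝ) * ∏ i, ((αp i).factorial : ℝ)) *
          ∑ x, p x * (∏ i, (enc d r β i x / r i) ^ αp i) *
            ∑ k ∈ (Fintype.piFinset fun _ : Xhat => Finset.range (α₀ + 1)).filter
                (fun k => ∑ i, k i = α₀),
              (∏ i ∈ Finset.univ.erase xh,
                  Gfun (k i) (αp i) (fun j => Pval d (fun a c => enc d r β a c) j i x)) *
                ((αp xh : ℝ) *
                    Gfun (k xh) (αp xh) (fun j => Pval d (fun a c => enc d r β a c) j xh x) -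
                  ((∑ i, αp i : ℕ) : ℝ) * ((1 + αp xh : ℕ) : ℝ) * enc d r β xh x *
                    Gfun (k xh) (1 + αp xh)
                      (fun j => Pval d (fun a c => enc d r β a c) j xh x)) := by
  have hf : SmoothOnPos (fun β' r' => r' xh - BA p d β' r' xh) :=
    idSubBARDeriv_zero p d xh ▸ smoothOnPos_idSubBARDeriv p d xh 0
  have hsmooth (x : X) :
      ContDiffAt ℝ α₀ (fun c => p x * encRDeriv d xh x αp c r) β := by
    have h (b : Xhat → ℕ) : ContDiff ℝ α₀ (fun c => ∏ i, (enc d r c i x / r i) ^ b i) :=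
      contDiff_prod fun i _ => ((contDiff_enc_div d hr0 i x).of_le
        (by exact_mod_cast (le_top : (α₀ : ℕ∞) ≤ ⊤))).pow (b i)
    simp only [encRDeriv_eq d xh x hαp _ hr0]
    exact (contDiff_const.mul (contDiff_const.mul
      ((contDiff_const.mul (h _)).sub (contDiff_const.mul (h _))))).contDiffAt
  rw [hf.mixedD_eqOnPos α₀ αp β r hr0, (mixedD_zero_idSubBA p d xh αp).pB_iterate α₀ β r hr0,
    pB_iterate_eq_iteratedDeriv]
  unfold idSubBARDeriv
  rw [iteratedDeriv_fun_sub contDiffAt_const (ContDiffAt.sum fun x _ => hsmooth x),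
    iteratedDeriv_coordRDeriv xh hαp, iteratedDeriv_fun_sum fun x _ => hsmooth x, Finset.mul_sum]
  congr 1
  refine Finset.sum_congr rfl fun x _ => ?_
  rw [iteratedDeriv_const_mul_field, iteratedDeriv_encRDeriv d xh x hαp β hr0]
  ring
end
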